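/- Define f : (0,∞) → ℝ by f(λ) = 2λ·e^{−2λ} + e^{−λ}·√(3e^{−λ} + 1)·Σ_{k=2}^{∞} λᵏ√k / k!. Then for every λ > 0, f(λ) ≤ 2λ·e^{−2λ} + (1/√8)·√(3e^{−λ} + 1)·((λ + 2) − e^{−λ}·(3λ + 2)). -/

import Mathlib

/-- The series `∑_{k=2}^∞ λᵏ √k / k!`. -/
noncomputable def erSeries (l : ℝ) : ℝ :=
  ∑' k : ℕ, l ^ (k + 2) * Real.sqrt ((k : ℝ) + 2) / (Nat.factorial (k + 2) : ℝ)

/-- The asymptotic bound `f(λ) = 2λe^{-2λ} + e^{-λ}√(3e^{-λ}+1) ∑_{k=2}^∞ λᵏ√k/k!`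
for the energy per vertex of a sparse Erdős–Rényi graph. -/
noncomputable def erBound (l : ℝ) : ℝ :=
  2 * l * Real.exp (-2 * l) +
    Real.exp (-l) * Real.sqrt (3 * Real.exp (-l) + 1) * erSeries l

open Nat in
/-- The exponential series without its first `m` terms. -/
lemma Real.hasSum_exp_tail (x : ℝ) (m : ℕ) :
    HasSum (fun k : ℕ => x ^ (k + m) / ((k + m)! : ℝ))
      (Real.exp x - ∑ i ∈ Finset.range m, x ^ i / (i ! : ℝ)) := by
  rw [hasSum_nat_add_iff' (f := fun k : ℕ => x ^ k / (k ! : ℝ)) m, Real.exp_eq_exp_ℝ]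
  exact NormedSpace.expSeries_div_hasSum_exp x

lemma Real.sqrt_le_add_two_div_sqrt_eight {x : ℝ} (hx : 0 ≤ x) : √x ≤ (x + 2) / √8 := by
  rw [le_div_iff₀ (by positivity), ← Real.sqrt_mul hx]
  apply Real.sqrt_le_iff.mpr
  exact ⟨by positivity, by nlinarith [sq_nonneg (x - 2)]⟩

lemma hasSum_pow_mul_add_two_div_factorial (l : ℝ) :
    HasSum (fun k : ℕ => l ^ (k + 2) * ((k : ℝ) + 2 + 2) / (Nat.factorial (k + 2) : ℝ))
      (Real.exp l * (l + 2) - (3 * l + 2)) := by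
  convert! ((Real.hasSum_exp_tail l 1).mul_left l).add ((Real.hasSum_exp_tail l 2).mul_left 2)
    using 1
  · funext k
    rw [Nat.factorial_succ (k + 1)]
    have := Nat.cast_ne_zero (R := ℝ) |>.mpr (Nat.factorial_ne_zero (k + 1))
    have : (k : ℝ) + 1 + 1 ≠ 0 := by positivity
    push_cast
    field_simp
    ring
  · simp [Finset.sum_range_succ]
    ring

lemma erSeries_le {l : ℝ} (hl : 0 ≤ l) :
    erSeries l ≤ (Real.exp l * (l + 2) - (3 * l + 2)) / √8 := by
  have hs := (hasSum_pow_mul_add_two_div_factorial l).div_const (√8)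
  have hle (k : ℕ) : l ^ (k + 2) * √((k : ℝ) + 2) / (Nat.factorial (k + 2) : ℝ) ≤
      l ^ (k + 2) * ((k : ℝ) + 2 + 2) / (Nat.factorial (k + 2) : ℝ) / √8 := by
    rw [div_right_comm _ _ √8, mul_div_assoc _ _ √8]
    gcongr
    exact Real.sqrt_le_add_two_div_sqrt_eight (by positivity)
  rw [erSeries, ← hs.tsum_eq]
  exact (hs.summable.of_nonneg_of_le (fun k => by positivity) hle).tsum_le_tsum hle hs.summable

/-- For every `λ > 0`,
`f(λ) ≤ 2λe^{-2λ} + (1/√8)√(3e^{-λ}+1)((λ+2) - e^{-λ}(3λ+2))`. -/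
theorem erBound_le_explicit : ∀ l : ℝ, 0 < l →
    erBound l ≤ 2 * l * Real.exp (-2 * l) +
      1 / Real.sqrt 8 * Real.sqrt (3 * Real.exp (-l) + 1) *
        ((l + 2) - Real.exp (-l) * (3 * l + 2)) := by
  intro l hl
  have he : Real.exp (-l) * Real.exp l = 1 := by rw [← Real.exp_add]; simp
  rw [erBound]
  refine add_le_add le_rfl ?_
  calc Real.exp (-l) * √(3 * Real.exp (-l) + 1) * erSeries l
      ≤ Real.exp (-l) * √(3 * Real.exp (-l) + 1) *
          ((Real.exp l * (l + 2) - (3 * l + 2)) / √8) := by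
        gcongr
        exact erSeries_le hl.le
    _ = _ := by linear_combination √(3 * Real.exp (-l) + 1) / √8 * (l + 2) * he
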